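/- Every instance with three agents having additive nonnegative cost functions over a finite set of chores admits a (19/18)-minimax allocation: an allocation A = (A_1,A_2,A_3) with cost v^i(A_i) ≤ (19/18)·mmS^i for every agent i. -/

import Mathlib

/-- The total value of the bundle given to agent `j` by allocation/partition `f`. -/
noncomputable def bundleVal {M : Type*} [Fintype M] {n : ℕ} (v : M → ℝ)
    (f : M → Fin n) (j : Fin n) : ℝ :=
  ∑ e ∈ Finset.univ.filter (fun e => f e = j), v e

/-- The maximin share: max over partitions into `n` bundles of the min bundle value. -/
noncomputable def MMS {M : Type*} [Fintype M] [DecidableEq M] (n : ℕ) [NeZero n]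
    (v : M → ℝ) : ℝ :=
  Finset.univ.sup' Finset.univ_nonempty fun f : M → Fin n =>
    Finset.univ.inf' Finset.univ_nonempty fun j => bundleVal v f j

/-- The minimax share: min over partitions into `n` bundles of the max bundle value. -/
noncomputable def mmS {M : Type*} [Fintype M] [DecidableEq M] (n : ℕ) [NeZero n]
    (v : M → ℝ) : ℝ :=
  Finset.univ.inf' Finset.univ_nonempty fun f : M → Fin n =>
    Finset.univ.sup' Finset.univ_nonempty fun j => bundleVal v f j

/-- The proportional share: total value divided by the number `n` of agents. -/
noncomputable def PS {M : Type*} [Fintype M] (n : ℕ) (v : M → ℝ) : ℝ :=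
  (∑ e, v e) / n

open Finset

/-- The total of the `3 × 3` table `x` over the cells that `f` assigns to `k`. -/
def load (x : Fin 3 → Fin 3 → ℝ) (f : Fin 3 → Fin 3 → Fin 3) (k : Fin 3) : ℝ :=
  ∑ i, ∑ j, if f i j = k then x i j else 0

theorem load_mono {x y : Fin 3 → Fin 3 → ℝ} (h : ∀ i j, x i j ≤ y i j)
    (f : Fin 3 → Fin 3 → Fin 3) (k : Fin 3) : load x f k ≤ load y f k :=
  sum_le_sum fun i _ => sum_le_sum fun j _ => by split_ifs <;> simp [h]

theorem load_const_mul (c : ℝ) (x : Fin 3 → Fin 3 → ℝ) (f : Fin 3 → Fin 3 → Fin 3)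
    (k : Fin 3) : load (fun i j => c * x i j) f k = c * load x f k := by
  simp [load, mul_sum]

theorem load_perm (x : Fin 3 → Fin 3 → ℝ) (f : Fin 3 → Fin 3 → Fin 3) (k : Fin 3)
    (σ τ : Equiv.Perm (Fin 3)) :
    load x (fun i j => f (σ.symm i) (τ.symm j)) k = load (fun i j => x (σ i) (τ j)) f k := by
  unfold load
  rw [← Equiv.sum_comp σ]
  refine sum_congr rfl fun i _ => ?_
  rw [← Equiv.sum_comp τ]
  simp

/-- A table `x` with row sums `18` and a table `y` with column sums `18` such that, whenever the
cells are cut into three parts (the `k`-th part being the zeros of `f k`), some part leaves a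
complement that `f k` fails to split into a bundle of `x`-cost and a bundle of `y`-cost at most
`19`. -/
structure Unsplittable (x y : Fin 3 → Fin 3 → ℝ) : Prop where
  x_nonneg : ∀ i j, 0 ≤ x i j
  y_nonneg : ∀ i j, 0 ≤ y i j
  row_sum : ∀ i, ∑ j, x i j = 18
  col_sum : ∀ j, ∑ i, y i j = 18
  exists_lt : ∀ f : Fin 3 → Fin 3 → Fin 3 → Fin 3,
    (∀ i j, (univ.filter fun k => f k i j = 0).card = 1) →
      ∃ k, 19 < load x (f k) 1 ∨ 19 < load y (f k) 2

namespace Unsplittable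

variable {x y : Fin 3 → Fin 3 → ℝ}

theorem perm (h : Unsplittable x y) (σ τ : Equiv.Perm (Fin 3)) :
    Unsplittable (fun i j => x (σ i) (τ j)) (fun i j => y (σ i) (τ j)) where
  x_nonneg i j := h.x_nonneg _ _
  y_nonneg i j := h.y_nonneg _ _
  row_sum i := (Equiv.sum_comp τ _).trans (h.row_sum (σ i))
  col_sum j := (Equiv.sum_comp σ fun i => y i (τ j)).trans (h.col_sum (τ j))
  exists_lt f hf := by
    obtain ⟨k, hk⟩ := h.exists_lt (fun k i j => f k (σ.symm i) (τ.symm j)) fun i j => hf _ _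
    exact ⟨k, by simpa only [load_perm] using hk⟩

theorem transpose (h : Unsplittable x y) :
    Unsplittable (fun i j => y j i) (fun i j => x j i) where
  x_nonneg i j := h.y_nonneg _ _
  y_nonneg i j := h.x_nonneg _ _
  row_sum := h.col_sum
  col_sum := h.row_sum
  exists_lt f hf := by
    have key : ∀ (z : Fin 3 → Fin 3 → ℝ) (g : Fin 3 → Fin 3 → Fin 3) (k : Fin 3),
        load z (fun i j => Equiv.swap 1 2 (g j i)) (Equiv.swap 1 2 k)
          = load (fun i j => z j i) g k := by
      intro z g k
      unfold load
      rw [sum_comm]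
      simp
    obtain ⟨k, hk⟩ := h.exists_lt (fun k i j => Equiv.swap 1 2 (f k j i)) fun i j => by
      rw [← hf j i]
      congr 1
      refine filter_congr fun k _ => ?_
      generalize f k j i = a
      revert a
      decide
    refine ⟨k, hk.symm.imp (fun hy => ?_) fun hx => ?_⟩
    · rw [← key y (f k) 1]
      simpa using hy
    · rw [← key x (f k) 2]
      simpa using hx

/-- At most one row is acceptable to the agent with costs `y`. -/
theorem exists_row (h : Unsplittable x y) : ∃ i₀, ∀ i ≠ i₀, 19 < ∑ j, y i j := by
  by_contra! hc
  obtain ⟨a, -, ha⟩ := hc 0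
  obtain ⟨b, hba, hb⟩ := hc a
  obtain ⟨k, hk⟩ := h.exists_lt (fun k i _ => if i = k then 0 else
      if k = a then (if i = b then 2 else 1) else (if i = a then 2 else 1)) (by
    intro i _
    rw [card_eq_one]
    exact ⟨i, by ext k; simp only [mem_filter, mem_univ, true_and, mem_singleton]; grind⟩)
  have key : ∀ (z : Fin 3 → Fin 3 → ℝ) (g : Fin 3 → Fin 3) (l c : Fin 3),
      (∀ i, g i = l → i = c) → (∀ i j, 0 ≤ z i j) →
        load z (fun i _ => g i) l ≤ ∑ j, z c j := by
    intro z g l c hg hz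
    unfold load
    rw [← add_sum_erase _ _ (mem_univ c)]
    have h0 : ∑ i ∈ univ.erase c, ∑ j, (if g i = l then z i j else 0) = 0 := by
      refine sum_eq_zero fun i hi => sum_eq_zero fun j _ => if_neg fun hl => ?_
      exact (mem_erase.1 hi).1 (hg i hl)
    rw [h0, add_zero]
    exact sum_le_sum fun j _ => by split_ifs <;> simp [hz]
  obtain ⟨c, hc⟩ : ∃ c, ∀ i, (if i = k then 0 else if k = a then (if i = b then 2 else 1)
      else (if i = a then 2 else 1) : Fin 3) = 1 → i = c := by
    clear hk ha hb
    decide +revert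
  obtain ⟨d, hda, hd⟩ : ∃ d, (d = a ∨ d = b) ∧ ∀ i, (if i = k then 0 else
      if k = a then (if i = b then 2 else 1) else (if i = a then 2 else 1) : Fin 3) = 2 →
      i = d := by
    clear hk ha hb hc
    decide +revert
  rcases hk with hk | hk
  · linarith [key x _ 1 c hc h.x_nonneg, h.row_sum c]
  · have := key y _ 2 d hd h.y_nonneg
    rcases hda with rfl | rfl <;> linarith

end Unsplittable

/-- An unsplittable pair of tables in which row `0` and column `0` are the only ones that both
agents may find acceptable. -/
structure Unsplittable.Normal (x y : Fin 3 → Fin 3 → ℝ) : Prop extends Unsplittable x y where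
  lt_row : ∀ i ≠ 0, 19 < ∑ j, y i j
  lt_col : ∀ j ≠ 0, 19 < ∑ i, x i j

namespace Unsplittable.Normal

variable {x y : Fin 3 → Fin 3 → ℝ}

theorem rows (h : Normal x y) :
    Normal (fun i j => x (![0, 2, 1] i) j) (fun i j => y (![0, 2, 1] i) j) where
  toUnsplittable := by
    have h1 : (![0, 2, 1] : Fin 3 → Fin 3) = Equiv.swap 1 2 := by decide
    simpa only [h1, Equiv.refl_apply] using h.toUnsplittable.perm (Equiv.swap 1 2) (Equiv.refl _)
  lt_row i hi := h.lt_row _ (by decide +revert)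
  lt_col j hj := by
    have := h.lt_col j hj
    simp only [Fin.sum_univ_three] at this ⊢
    calc _ < _ := this
      _ = x 0 j + x 2 j + x 1 j := by ring

theorem transpose (h : Normal x y) : Normal (fun i j => y j i) (fun i j => x j i) where
  toUnsplittable := h.toUnsplittable.transpose
  lt_row := h.lt_col
  lt_col := h.lt_row

theorem cols (h : Normal x y) :
    Normal (fun i j => x i (![0, 2, 1] j)) (fun i j => y i (![0, 2, 1] j)) :=
  h.transpose.rows.transpose

theorem basic (h : Normal x y) :
    (x 0 0 + x 0 1 + x 0 2 = 18 ∧ x 1 0 + x 1 1 + x 1 2 = 18 ∧ x 2 0 + x 2 1 + x 2 2 = 18) ∧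
    (y 0 0 + y 1 0 + y 2 0 = 18 ∧ y 0 1 + y 1 1 + y 2 1 = 18 ∧ y 0 2 + y 1 2 + y 2 2 = 18) ∧
    (19 < x 0 1 + x 1 1 + x 2 1 ∧ 19 < x 0 2 + x 1 2 + x 2 2) ∧
    (19 < y 1 0 + y 1 1 + y 1 2 ∧ 19 < y 2 0 + y 2 1 + y 2 2) := by
  have h1 := h.row_sum
  have h2 := h.col_sum
  have h3 := h.lt_col
  have h4 := h.lt_row
  simp only [Fin.sum_univ_three] at h1 h2 h3 h4
  exact ⟨⟨h1 0, h1 1, h1 2⟩, ⟨h2 0, h2 1, h2 2⟩, ⟨h3 1 (by decide), h3 2 (by decide)⟩,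
    ⟨h4 1 (by decide), h4 2 (by decide)⟩⟩

theorem x_cells_nonneg (h : Normal x y) :
    (0 ≤ x 0 0 ∧ 0 ≤ x 0 1 ∧ 0 ≤ x 0 2) ∧ (0 ≤ x 1 0 ∧ 0 ≤ x 1 1 ∧ 0 ≤ x 1 2) ∧
    (0 ≤ x 2 0 ∧ 0 ≤ x 2 1 ∧ 0 ≤ x 2 2) := by
  simp [h.x_nonneg]

theorem y_cells_nonneg (h : Normal x y) :
    (0 ≤ y 0 0 ∧ 0 ≤ y 0 1 ∧ 0 ≤ y 0 2) ∧ (0 ≤ y 1 0 ∧ 0 ≤ y 1 1 ∧ 0 ≤ y 1 2) ∧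
    (0 ≤ y 2 0 ∧ 0 ≤ y 2 1 ∧ 0 ≤ y 2 2) := by
  simp [h.y_nonneg]

/-- A cut all of whose complements are split within the bounds is impossible. -/
theorem elim_of_load_le (h : Normal x y) (f : Fin 3 → Matrix (Fin 3) (Fin 3) (Fin 3))
    (hf : ∀ i j, (univ.filter fun k => f k i j = 0).card = 1 := by decide)
    (hle : ∀ k, load x (f k) 1 ≤ 19 ∧ load y (f k) 2 ≤ 19 := by
      simp [load, Fin.forall_fin_succ, Fin.sum_univ_three]
      constructorm* _ ∧ _ <;> linarith) : False := by
  obtain ⟨k, hk⟩ := h.exists_lt f hf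
  exact hk.elim (hle k).1.not_gt (hle k).2.not_gt

/-- Here and below, the indices in a name list the cells of the sum that is compared with `19`.
Each bound holds because its failure makes a cut and three splits of its complements available. -/
theorem lt_x_10_11_20_21 (h : Normal x y) :
    19 < x 1 0 + x 1 1 + x 2 0 + x 2 1 := by
  obtain ⟨⟨_, _, _⟩, ⟨_, _, _⟩, ⟨_, _⟩, ⟨_, _⟩⟩ := h.basic
  obtain ⟨⟨_, _, _⟩, ⟨_, _, _⟩, ⟨_, _, _⟩⟩ := h.x_cells_nonneg
  obtain ⟨⟨_, _, _⟩, ⟨_, _, _⟩, ⟨_, _, _⟩⟩ := h.y_cells_nonneg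
  by_contra! hc
  exact h.elim_of_load_le ![!![0, 0, 0; 1, 1, 2; 1, 1, 2], !![2, 2, 2; 1, 1, 1; 0, 0, 0],
    !![2, 2, 2; 0, 0, 0; 1, 1, 1]]

theorem lt_x_00_02_10_20 (h : Normal x y) :
    19 < x 0 0 + x 0 2 + x 1 0 + x 2 0 := by
  obtain ⟨⟨_, _, _⟩, ⟨_, _, _⟩, ⟨_, _⟩, ⟨_, _⟩⟩ := h.basic
  obtain ⟨⟨_, _, _⟩, ⟨_, _, _⟩, ⟨_, _, _⟩⟩ := h.x_cells_nonneg
  obtain ⟨⟨_, _, _⟩, ⟨_, _, _⟩, ⟨_, _, _⟩⟩ := h.y_cells_nonneg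
  have := h.lt_x_10_11_20_21
  by_contra! hc
  exact h.elim_of_load_le ![!![0, 2, 0; 0, 2, 1; 0, 2, 1], !![1, 2, 1; 1, 2, 0; 1, 2, 0],
    !![1, 0, 1; 1, 0, 2; 1, 0, 2]]

theorem lt_y_00_01_02_12 (h : Normal x y) :
    19 < y 0 0 + y 0 1 + y 0 2 + y 1 2 := by
  obtain ⟨⟨_, _, _⟩, ⟨_, _, _⟩, ⟨_, _⟩, ⟨_, _⟩⟩ := h.basic
  obtain ⟨⟨_, _, _⟩, ⟨_, _, _⟩, ⟨_, _, _⟩⟩ := h.x_cells_nonneg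
  obtain ⟨⟨_, _, _⟩, ⟨_, _, _⟩, ⟨_, _, _⟩⟩ := h.y_cells_nonneg
  by_contra! hc
  exact h.elim_of_load_le ![!![0, 0, 2; 1, 1, 1; 0, 0, 2], !![1, 2, 0; 1, 2, 0; 1, 2, 0],
    !![2, 2, 2; 0, 0, 2; 1, 1, 1]]

theorem lt_x_10_11_12_20 (h : Normal x y) :
    19 < x 1 0 + x 1 1 + x 1 2 + x 2 0 := by
  obtain ⟨⟨_, _, _⟩, ⟨_, _, _⟩, ⟨_, _⟩, ⟨_, _⟩⟩ := h.basic
  obtain ⟨⟨_, _, _⟩, ⟨_, _, _⟩, ⟨_, _, _⟩⟩ := h.x_cells_nonneg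
  obtain ⟨⟨_, _, _⟩, ⟨_, _, _⟩, ⟨_, _, _⟩⟩ := h.y_cells_nonneg
  have : 19 < y 0 0 + y 2 0 + y 0 1 + y 0 2 := h.transpose.lt_x_00_02_10_20
  by_contra! hc
  exact h.elim_of_load_le ![!![0, 0, 0; 1, 1, 1; 1, 2, 2], !![2, 2, 2; 1, 1, 1; 0, 0, 0],
    !![2, 2, 2; 0, 0, 0; 1, 1, 1]]

theorem lt_x_01_10_11_22 (h : Normal x y) :
    19 < x 0 1 + x 1 0 + x 1 1 + x 2 2 := by
  obtain ⟨⟨_, _, _⟩, ⟨_, _, _⟩, ⟨_, _⟩, ⟨_, _⟩⟩ := h.basic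
  obtain ⟨⟨_, _, _⟩, ⟨_, _, _⟩, ⟨_, _, _⟩⟩ := h.x_cells_nonneg
  obtain ⟨⟨_, _, _⟩, ⟨_, _, _⟩, ⟨_, _, _⟩⟩ := h.y_cells_nonneg
  have := h.lt_x_00_02_10_20
  have : 19 < x 0 0 + x 0 1 + x 1 0 + x 2 0 := h.cols.lt_x_00_02_10_20
  have : 19 < y 0 0 + y 1 0 + y 0 1 + y 0 2 := h.transpose.cols.lt_x_00_02_10_20
  have : 19 < y 0 0 + y 0 1 + y 0 2 + y 2 2 := h.rows.lt_y_00_01_02_12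
  have : 19 < x 0 0 + x 2 0 + x 1 0 + x 1 1 := h.transpose.cols.lt_y_00_01_02_12
  have := h.lt_x_10_11_12_20
  have : 19 < x 2 0 + x 2 1 + x 2 2 + x 1 0 := h.rows.lt_x_10_11_12_20
  by_contra! hc
  have : 19 < y 0 0 + y 0 2 + y 1 2 := by
    by_contra! hc
    exact h.elim_of_load_le ![!![0, 2, 0; 1, 2, 0; 1, 2, 1], !![2, 2, 2; 1, 1, 1; 0, 0, 0],
      !![2, 0, 2; 0, 0, 2; 1, 1, 1]]
  have : 19 < x 0 2 + x 1 0 + x 1 2 + x 2 0 := by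
    by_contra! hc
    exact h.elim_of_load_le ![!![0, 2, 1; 1, 2, 1; 1, 2, 0], !![1, 0, 2; 1, 0, 2; 1, 0, 2],
      !![1, 2, 0; 0, 2, 0; 0, 2, 1]]
  have : 19 < x 0 1 + x 1 0 + x 2 0 + x 2 1 := by
    by_contra! hc
    exact h.elim_of_load_le ![!![0, 1, 2; 1, 0, 2; 1, 1, 2], !![1, 2, 0; 1, 2, 0; 1, 2, 0],
      !![1, 0, 2; 0, 1, 2; 0, 0, 2]]
  have : x 0 0 + x 0 1 + x 1 0 ≤ 19 := by
    by_contra! hc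
    exact h.elim_of_load_le ![!![0, 2, 0; 1, 2, 1; 1, 2, 0], !![1, 0, 2; 1, 1, 2; 0, 0, 2],
      !![2, 2, 2; 0, 0, 0; 1, 1, 1]]
  have : 19 < x 1 1 + x 2 0 + x 2 1 := by
    by_contra! hc
    exact h.elim_of_load_le ![!![0, 0, 2; 0, 1, 2; 1, 1, 2], !![1, 2, 0; 1, 2, 0; 1, 2, 0],
      !![1, 1, 2; 1, 0, 2; 0, 0, 2]]
  have : 19 < x 0 2 + x 1 2 + x 2 0 := by
    by_contra! hc
    exact h.elim_of_load_le ![!![0, 2, 1; 0, 2, 1; 1, 2, 0], !![1, 0, 2; 1, 0, 2; 1, 0, 2],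
      !![1, 2, 0; 1, 2, 0; 0, 2, 1]]
  have : 19 < y 0 1 + y 0 2 + y 1 2 := by
    by_contra! hc
    exact h.elim_of_load_le ![!![0, 2, 2; 0, 0, 2; 1, 1, 1], !![1, 2, 0; 1, 2, 0; 1, 2, 0],
      !![1, 0, 2; 1, 1, 2; 0, 0, 2]]
  have : 19 < y 0 0 + y 0 2 + y 2 0 := by
    by_contra! hc
    exact h.elim_of_load_le ![!![0, 2, 0; 1, 2, 1; 0, 2, 1], !![2, 0, 2; 1, 1, 1; 2, 0, 0],
      !![2, 2, 2; 0, 0, 0; 1, 1, 1]]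
  have : 19 < y 1 2 + y 2 0 + y 2 2 := by
    by_contra! hc
    exact h.elim_of_load_le ![!![0, 2, 0; 0, 2, 2; 1, 1, 1], !![2, 2, 2; 1, 1, 1; 0, 0, 0],
      !![2, 0, 2; 2, 0, 0; 1, 1, 1]]
  have : 19 < y 0 0 + y 0 1 + y 2 0 := by
    by_contra! hc
    exact h.elim_of_load_le ![!![0, 0, 2; 1, 1, 1; 0, 2, 2], !![2, 2, 0; 1, 1, 1; 2, 0, 0],
      !![2, 2, 2; 0, 0, 0; 1, 1, 1]]
  exact h.elim_of_load_le ![!![0, 2, 2; 1, 1, 1; 0, 2, 0], !![1, 0, 2; 1, 0, 2; 1, 0, 2],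
    !![2, 2, 0; 0, 2, 0; 1, 1, 1]]

theorem y_12_21_le (h : Normal x y) :
    y 1 2 + y 2 1 ≤ 19 := by
  obtain ⟨⟨_, _, _⟩, ⟨_, _, _⟩, ⟨_, _⟩, ⟨_, _⟩⟩ := h.basic
  obtain ⟨⟨_, _, _⟩, ⟨_, _, _⟩, ⟨_, _, _⟩⟩ := h.x_cells_nonneg
  obtain ⟨⟨_, _, _⟩, ⟨_, _, _⟩, ⟨_, _, _⟩⟩ := h.y_cells_nonneg
  have : 19 < y 0 0 + y 1 0 + y 0 1 + y 0 2 := h.transpose.cols.lt_x_00_02_10_20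
  have : 19 < y 0 0 + y 0 1 + y 0 2 + y 2 2 := h.rows.lt_y_00_01_02_12
  have : 19 < y 0 0 + y 0 2 + y 0 1 + y 1 1 := h.cols.lt_y_00_01_02_12
  have : 19 < y 0 2 + y 1 2 + y 2 2 + y 0 1 := h.transpose.rows.lt_x_10_11_12_20
  have : 19 < y 1 0 + y 0 1 + y 1 1 + y 2 2 := h.transpose.lt_x_01_10_11_22
  have : 19 < y 2 0 + y 0 2 + y 2 2 + y 1 1 := h.transpose.rows.cols.lt_x_01_10_11_22
  by_contra! hc
  exact h.elim_of_load_le ![!![0, 2, 2; 1, 1, 1; 0, 2, 0], !![1, 0, 2; 1, 0, 2; 1, 0, 2],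
    !![2, 2, 0; 0, 2, 0; 1, 1, 1]]

theorem lt_x_10_11_20_22 (h : Normal x y) :
    19 < x 1 0 + x 1 1 + x 2 0 + x 2 2 := by
  obtain ⟨⟨_, _, _⟩, ⟨_, _, _⟩, ⟨_, _⟩, ⟨_, _⟩⟩ := h.basic
  obtain ⟨⟨_, _, _⟩, ⟨_, _, _⟩, ⟨_, _, _⟩⟩ := h.x_cells_nonneg
  obtain ⟨⟨_, _, _⟩, ⟨_, _, _⟩, ⟨_, _, _⟩⟩ := h.y_cells_nonneg
  have := h.y_12_21_le
  by_contra! hc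
  exact h.elim_of_load_le ![!![0, 0, 0; 1, 1, 2; 1, 2, 1], !![2, 2, 2; 1, 1, 1; 0, 0, 0],
    !![2, 2, 2; 0, 0, 0; 1, 1, 1]]

theorem lt_x_01_02_10_11 (h : Normal x y) :
    19 < x 0 1 + x 0 2 + x 1 0 + x 1 1 := by
  obtain ⟨⟨_, _, _⟩, ⟨_, _, _⟩, ⟨_, _⟩, ⟨_, _⟩⟩ := h.basic
  obtain ⟨⟨_, _, _⟩, ⟨_, _, _⟩, ⟨_, _, _⟩⟩ := h.x_cells_nonneg
  obtain ⟨⟨_, _, _⟩, ⟨_, _, _⟩, ⟨_, _, _⟩⟩ := h.y_cells_nonneg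
  have := h.lt_x_00_02_10_20
  have : 19 < y 0 0 + y 1 0 + y 0 1 + y 0 2 := h.transpose.cols.lt_x_00_02_10_20
  have : 19 < x 0 2 + x 2 0 + x 2 2 + x 1 1 := h.rows.cols.lt_x_01_10_11_22
  have : 19 < y 1 0 + y 0 1 + y 1 1 + y 2 2 := h.transpose.lt_x_01_10_11_22
  by_contra! hc
  have : 19 < y 0 0 + y 1 2 := by
    by_contra! hc
    exact h.elim_of_load_le ![!![0, 2, 1; 1, 2, 0; 1, 2, 1], !![2, 2, 2; 1, 1, 1; 0, 0, 0],
      !![2, 0, 0; 0, 0, 2; 1, 1, 1]]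
  have : 19 < x 0 0 + x 1 2 := by
    by_contra! hc
    exact h.elim_of_load_le ![!![0, 2, 2; 2, 2, 0; 1, 1, 1], !![1, 2, 0; 0, 2, 1; 0, 2, 0],
      !![1, 0, 2; 1, 0, 2; 1, 0, 2]]
  have : 19 < x 1 0 + x 1 2 + x 2 2 := by
    by_contra! hc
    exact h.elim_of_load_le ![!![0, 2, 0; 1, 2, 1; 0, 2, 1], !![2, 0, 2; 1, 1, 1; 2, 0, 0],
      !![2, 2, 2; 0, 0, 0; 1, 1, 1]]
  exact h.elim_of_load_le ![!![0, 0, 2; 0, 1, 2; 1, 1, 2], !![1, 2, 0; 1, 2, 0; 1, 2, 0],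
    !![1, 1, 2; 1, 0, 2; 0, 0, 2]]

theorem lt_x_02_10_20_22 (h : Normal x y) :
    19 < x 0 2 + x 1 0 + x 2 0 + x 2 2 := by
  obtain ⟨⟨_, _, _⟩, ⟨_, _, _⟩, ⟨_, _⟩, ⟨_, _⟩⟩ := h.basic
  obtain ⟨⟨_, _, _⟩, ⟨_, _, _⟩, ⟨_, _, _⟩⟩ := h.x_cells_nonneg
  obtain ⟨⟨_, _, _⟩, ⟨_, _, _⟩, ⟨_, _, _⟩⟩ := h.y_cells_nonneg
  have : 19 < y 2 0 + y 1 0 + y 0 2 + y 2 2 := h.transpose.rows.cols.lt_x_01_02_10_11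
  by_contra! hc
  exact h.elim_of_load_le ![!![0, 2, 1; 1, 2, 0; 1, 2, 1], !![2, 2, 2; 1, 1, 1; 0, 0, 0],
    !![2, 0, 0; 0, 0, 2; 1, 1, 1]]

theorem lt_x_01_10_20_22 (h : Normal x y) :
    19 < x 0 1 + x 1 0 + x 2 0 + x 2 2 := by
  obtain ⟨⟨_, _, _⟩, ⟨_, _, _⟩, ⟨_, _⟩, ⟨_, _⟩⟩ := h.basic
  obtain ⟨⟨_, _, _⟩, ⟨_, _, _⟩, ⟨_, _, _⟩⟩ := h.x_cells_nonneg
  obtain ⟨⟨_, _, _⟩, ⟨_, _, _⟩, ⟨_, _, _⟩⟩ := h.y_cells_nonneg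
  have : 19 < x 0 0 + x 0 1 + x 1 0 + x 2 0 := h.cols.lt_x_00_02_10_20
  have := h.lt_x_01_10_11_22
  have : 19 < y 1 0 + y 0 1 + y 1 1 + y 2 2 := h.transpose.lt_x_01_10_11_22
  have : 19 < x 0 1 + x 1 0 + x 2 0 + x 2 1 := h.cols.lt_x_02_10_20_22
  have : 19 < x 0 1 + x 2 0 + x 1 0 + x 1 1 := h.rows.cols.lt_x_02_10_20_22
  have : 19 < y 2 0 + y 0 1 + y 0 2 + y 2 2 := h.transpose.lt_x_02_10_20_22
  have : 19 < y 1 0 + y 0 2 + y 0 1 + y 1 1 := h.transpose.rows.cols.lt_x_02_10_20_22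
  by_contra! hc
  have : 19 < y 0 0 + y 0 2 + y 2 0 := by
    by_contra! hc
    exact h.elim_of_load_le ![!![0, 2, 0; 1, 2, 1; 0, 2, 1], !![2, 0, 2; 1, 1, 1; 2, 0, 0],
      !![2, 2, 2; 0, 0, 0; 1, 1, 1]]
  have : 19 < x 0 0 + x 1 0 + x 1 1 := by
    by_contra! hc
    exact h.elim_of_load_le ![!![0, 2, 0; 1, 2, 1; 1, 2, 0], !![1, 0, 2; 1, 1, 2; 0, 0, 2],
      !![2, 2, 2; 0, 0, 0; 1, 1, 1]]
  have : 19 < x 1 0 + x 1 1 + x 2 0 := by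
    by_contra! hc
    exact h.elim_of_load_le ![!![0, 0, 2; 1, 1, 2; 1, 0, 2], !![2, 2, 0; 1, 1, 1; 0, 2, 0],
      !![2, 2, 2; 0, 0, 0; 1, 1, 1]]
  exact h.elim_of_load_le ![!![0, 0, 2; 1, 0, 2; 1, 1, 2], !![2, 2, 2; 1, 1, 1; 0, 0, 0],
    !![1, 2, 0; 0, 2, 0; 1, 2, 1]]

theorem x_00_10_21_le (h : Normal x y) :
    x 0 0 + x 1 0 + x 2 1 ≤ 19 := by
  obtain ⟨⟨_, _, _⟩, ⟨_, _, _⟩, ⟨_, _⟩, ⟨_, _⟩⟩ := h.basic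
  obtain ⟨⟨_, _, _⟩, ⟨_, _, _⟩, ⟨_, _, _⟩⟩ := h.x_cells_nonneg
  obtain ⟨⟨_, _, _⟩, ⟨_, _, _⟩, ⟨_, _, _⟩⟩ := h.y_cells_nonneg
  have : 19 < x 0 0 + x 1 0 + x 2 0 + x 2 2 := h.transpose.rows.lt_y_00_01_02_12
  have : 19 < x 0 0 + x 2 0 + x 1 0 + x 1 1 := h.transpose.cols.lt_y_00_01_02_12
  have : 19 < x 0 0 + x 2 0 + x 1 0 + x 1 2 := h.transpose.rows.cols.lt_y_00_01_02_12
  have : 19 < y 2 0 + y 0 2 + y 2 2 + y 1 1 := h.transpose.rows.cols.lt_x_01_10_11_22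
  have := h.lt_x_10_11_20_22
  have : 19 < y 0 1 + y 1 1 + y 0 2 + y 2 2 := h.transpose.lt_x_10_11_20_22
  have : 19 < y 2 0 + y 0 1 + y 0 2 + y 2 2 := h.transpose.lt_x_02_10_20_22
  have : 19 < x 0 1 + x 2 0 + x 1 0 + x 1 2 := h.rows.lt_x_01_10_20_22
  have : 19 < x 0 2 + x 2 0 + x 1 0 + x 1 1 := h.rows.cols.lt_x_01_10_20_22
  have : 19 < y 2 0 + y 0 2 + y 0 1 + y 1 1 := h.transpose.rows.cols.lt_x_01_10_20_22
  by_contra! hc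
  have : 19 < y 0 2 + y 2 1 + y 2 2 := by
    by_contra! hc
    exact h.elim_of_load_le ![!![0, 2, 0; 0, 2, 1; 1, 2, 1], !![2, 2, 2; 1, 1, 1; 0, 0, 0],
      !![2, 0, 2; 2, 0, 0; 1, 1, 1]]
  have : 19 < y 0 2 + y 1 0 + y 1 1 := by
    by_contra! hc
    exact h.elim_of_load_le ![!![0, 0, 2; 2, 2, 0; 1, 1, 1], !![2, 2, 2; 1, 1, 1; 0, 0, 0],
      !![2, 2, 0; 0, 0, 2; 1, 1, 1]]
  have : 19 < x 0 0 + x 1 0 + x 1 2 + x 2 2 := by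
    by_contra! hc
    exact h.elim_of_load_le ![!![0, 2, 1; 0, 2, 0; 1, 2, 0], !![1, 0, 2; 1, 0, 2; 1, 0, 2],
      !![1, 2, 0; 1, 2, 1; 0, 2, 1]]
  have : y 0 0 + y 0 1 + y 2 1 ≤ 19 := by
    by_contra! hc
    exact h.elim_of_load_le ![!![0, 2, 2; 0, 0, 2; 1, 1, 1], !![1, 2, 0; 1, 2, 0; 1, 2, 0],
      !![2, 0, 2; 1, 1, 1; 0, 0, 2]]
  have : x 0 0 + x 2 0 + x 2 1 ≤ 19 := by
    by_contra! hc
    exact h.elim_of_load_le ![!![0, 0, 2; 1, 1, 2; 1, 0, 2], !![2, 2, 0; 1, 1, 1; 0, 2, 0],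
      !![2, 2, 2; 0, 0, 0; 1, 1, 1]]
  have : x 0 0 + x 1 0 + x 2 2 ≤ 19 := by
    by_contra! hc
    exact h.elim_of_load_le ![!![0, 0, 2; 1, 1, 2; 1, 0, 2], !![2, 2, 0; 1, 1, 1; 0, 2, 0],
      !![2, 2, 2; 0, 0, 0; 1, 1, 1]]
  have : 19 < x 1 0 + x 2 0 + x 2 2 := by
    by_contra! hc
    exact h.elim_of_load_le ![!![0, 2, 0; 1, 2, 0; 1, 2, 1], !![2, 2, 2; 1, 1, 1; 0, 0, 0],
      !![1, 0, 2; 0, 0, 2; 1, 1, 2]]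
  have : 19 < x 0 0 + x 0 1 + x 1 0 := by
    by_contra! hc
    exact h.elim_of_load_le ![!![0, 0, 2; 0, 1, 2; 1, 1, 2], !![1, 2, 0; 1, 2, 0; 1, 2, 0],
      !![1, 1, 2; 1, 0, 2; 0, 0, 2]]
  exact h.elim_of_load_le ![!![0, 2, 1; 0, 2, 1; 1, 2, 0], !![1, 0, 2; 1, 0, 2; 1, 0, 2],
    !![1, 2, 0; 1, 2, 0; 0, 2, 1]]

theorem lt_y_01_20_22 (h : Normal x y) :
    19 < y 0 1 + y 2 0 + y 2 2 := by
  obtain ⟨⟨_, _, _⟩, ⟨_, _, _⟩, ⟨_, _⟩, ⟨_, _⟩⟩ := h.basic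
  obtain ⟨⟨_, _, _⟩, ⟨_, _, _⟩, ⟨_, _, _⟩⟩ := h.x_cells_nonneg
  obtain ⟨⟨_, _, _⟩, ⟨_, _, _⟩, ⟨_, _, _⟩⟩ := h.y_cells_nonneg
  have : y 0 0 + y 0 2 + y 2 1 ≤ 19 := h.transpose.rows.cols.x_00_10_21_le
  by_contra! hc
  exact h.elim_of_load_le ![!![0, 2, 0; 1, 1, 1; 2, 0, 2], !![2, 0, 2; 1, 1, 1; 0, 2, 0],
    !![2, 2, 2; 0, 0, 0; 1, 1, 1]]

theorem lt_y_01_02_22 (h : Normal x y) :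
    19 < y 0 1 + y 0 2 + y 2 2 := by
  obtain ⟨⟨_, _, _⟩, ⟨_, _, _⟩, ⟨_, _⟩, ⟨_, _⟩⟩ := h.basic
  obtain ⟨⟨_, _, _⟩, ⟨_, _, _⟩, ⟨_, _, _⟩⟩ := h.x_cells_nonneg
  obtain ⟨⟨_, _, _⟩, ⟨_, _, _⟩, ⟨_, _, _⟩⟩ := h.y_cells_nonneg
  have : 19 < x 1 0 + x 0 2 + x 2 2 := h.transpose.lt_y_01_20_22
  have : 19 < x 1 0 + x 0 1 + x 2 1 := h.transpose.rows.lt_y_01_20_22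
  have : 19 < x 2 0 + x 0 1 + x 1 1 := h.transpose.rows.cols.lt_y_01_20_22
  by_contra! hc
  exact h.elim_of_load_le ![!![0, 2, 2; 1, 1, 1; 0, 0, 2], !![1, 2, 0; 1, 2, 0; 1, 2, 0],
    !![1, 0, 2; 0, 0, 2; 1, 1, 2]]

theorem lt_x_02_20 (h : Normal x y) :
    19 < x 0 2 + x 2 0 := by
  obtain ⟨⟨_, _, _⟩, ⟨_, _, _⟩, ⟨_, _⟩, ⟨_, _⟩⟩ := h.basic
  obtain ⟨⟨_, _, _⟩, ⟨_, _, _⟩, ⟨_, _, _⟩⟩ := h.x_cells_nonneg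
  obtain ⟨⟨_, _, _⟩, ⟨_, _, _⟩, ⟨_, _, _⟩⟩ := h.y_cells_nonneg
  have : 19 < y 0 2 + y 2 0 + y 2 1 := h.cols.lt_y_01_20_22
  have : 19 < y 0 2 + y 1 0 + y 1 1 := h.rows.cols.lt_y_01_20_22
  have : 19 < x 2 0 + x 0 2 + x 1 2 := h.transpose.cols.lt_y_01_20_22
  have : 19 < x 2 0 + x 0 1 + x 1 1 := h.transpose.rows.cols.lt_y_01_20_22
  have := h.lt_y_01_02_22
  have : 19 < y 0 1 + y 0 2 + y 1 2 := h.rows.lt_y_01_02_22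
  have : 19 < y 0 2 + y 0 1 + y 2 1 := h.cols.lt_y_01_02_22
  by_contra! hc
  have : 19 < y 0 0 + y 0 1 + y 2 1 + y 2 2 := by
    by_contra! hc
    exact h.elim_of_load_le ![!![0, 2, 1; 0, 2, 0; 1, 2, 0], !![1, 0, 2; 1, 0, 2; 1, 0, 2],
      !![2, 2, 0; 1, 1, 1; 0, 2, 2]]
  have : 19 < y 0 0 + y 1 0 + y 2 1 + y 2 2 := by
    by_contra! hc
    exact h.elim_of_load_le ![!![0, 0, 2; 0, 2, 2; 1, 1, 1], !![2, 2, 2; 1, 1, 1; 0, 0, 0],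
      !![2, 2, 0; 2, 0, 0; 1, 1, 1]]
  have : 19 < y 0 2 + y 2 1 + y 2 2 := by
    by_contra! hc
    exact h.elim_of_load_le ![!![0, 0, 2; 1, 1, 1; 0, 2, 2], !![2, 2, 0; 1, 1, 1; 2, 0, 0],
      !![2, 2, 2; 0, 0, 0; 1, 1, 1]]
  have : 19 < x 0 0 + x 0 1 + x 1 0 := by
    by_contra! hc
    exact h.elim_of_load_le ![!![0, 0, 2; 0, 2, 2; 1, 1, 1], !![1, 2, 0; 1, 2, 0; 1, 2, 0],
      !![1, 1, 2; 1, 0, 2; 0, 0, 2]]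
  exact h.elim_of_load_le ![!![0, 2, 0; 0, 2, 2; 1, 1, 1], !![1, 2, 1; 1, 2, 0; 0, 2, 0],
    !![1, 0, 2; 1, 0, 2; 1, 0, 2]]

theorem elim (h : Normal x y) : False := by
  obtain ⟨⟨_, _, _⟩, ⟨_, _, _⟩, ⟨_, _⟩, ⟨_, _⟩⟩ := h.basic
  obtain ⟨⟨_, _, _⟩, ⟨_, _, _⟩, ⟨_, _, _⟩⟩ := h.x_cells_nonneg
  obtain ⟨⟨_, _, _⟩, ⟨_, _, _⟩, ⟨_, _, _⟩⟩ := h.y_cells_nonneg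
  have : 19 < y 2 0 + y 0 1 := h.transpose.rows.lt_x_02_20
  have : 19 < y 1 0 + y 0 2 := h.transpose.cols.lt_x_02_20
  linarith

end Unsplittable.Normal

open Unsplittable in
theorem Unsplittable.elim {x y : Fin 3 → Fin 3 → ℝ} (h : Unsplittable x y) : False := by
  obtain ⟨i₀, hi⟩ := h.exists_row
  obtain ⟨j₀, hj⟩ := h.transpose.exists_row
  refine Normal.elim (x := fun i j => x (Equiv.swap 0 i₀ i) (Equiv.swap 0 j₀ j))
    (y := fun i j => y (Equiv.swap 0 i₀ i) (Equiv.swap 0 j₀ j))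
    ⟨h.perm _ _, fun i hi0 => ?_, fun j hj0 => ?_⟩
  · rw [Equiv.sum_comp (Equiv.swap 0 j₀) (y (Equiv.swap 0 i₀ i))]
    exact hi _ (by simpa [Equiv.swap_apply_eq_iff] using hi0)
  · rw [Equiv.sum_comp (Equiv.swap 0 i₀) fun i => x i (Equiv.swap 0 j₀ j)]
    exact hj _ (by simpa [Equiv.swap_apply_eq_iff] using hj0)

theorem exists_split_of_sum_eq {x y : Fin 3 → Fin 3 → ℝ} (z : Fin 3 → Fin 3 → ℝ)
    (hx : ∀ i j, 0 ≤ x i j) (hy : ∀ i j, 0 ≤ y i j)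
    (hxr : ∀ i, ∑ j, x i j = 18) (hyc : ∀ j, ∑ i, y i j = 18) :
    ∃ f, 3 * load z f 0 ≤ ∑ i, ∑ j, z i j ∧ load x f 1 ≤ 19 ∧ load y f 2 ≤ 19 := by
  by_contra! hc
  refine Unsplittable.elim ⟨hx, hy, hxr, hyc, fun f hf => ?_⟩
  have hz : ∑ k, load z (f k) 0 = ∑ i, ∑ j, z i j := by
    unfold load
    rw [sum_comm]
    refine sum_congr rfl fun i _ => ?_
    rw [sum_comm]
    refine sum_congr rfl fun j _ => ?_
    rw [← sum_filter, sum_const, hf i j, one_smul]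
  obtain ⟨k, -, hk⟩ : ∃ k ∈ univ, load z (f k) 0 ≤ (∑ i, ∑ j, z i j) / 3 := by
    refine exists_le_of_sum_le univ_nonempty ?_
    rw [hz]
    simp
    linarith
  refine ⟨k, or_iff_not_imp_left.2 fun h1 => hc (f k) (by linarith) (not_lt.1 h1)⟩

theorem exists_split_of_sum_le {x y : Fin 3 → Fin 3 → ℝ} (z : Fin 3 → Fin 3 → ℝ)
    (hx : ∀ i j, 0 ≤ x i j) (hy : ∀ i j, 0 ≤ y i j)
    (hxr : ∀ i, ∑ j, x i j ≤ 18) (hyc : ∀ j, ∑ i, y i j ≤ 18) :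
    ∃ f, 3 * load z f 0 ≤ ∑ i, ∑ j, z i j ∧ load x f 1 ≤ 19 ∧ load y f 2 ≤ 19 := by
  have hx' : ∀ i j, x i j ≤ x i j + if j = 0 then 18 - ∑ j', x i j' else 0 := by
    intro i j
    split_ifs <;> linarith [hxr i]
  have hy' : ∀ i j, y i j ≤ y i j + if i = 0 then 18 - ∑ i', y i' j else 0 := by
    intro i j
    split_ifs <;> linarith [hyc j]
  obtain ⟨f, hz, h1, h2⟩ := exists_split_of_sum_eq z (fun i j => (hx i j).trans (hx' i j))
    (fun i j => (hy i j).trans (hy' i j)) (fun i => by simp [sum_add_distrib])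
    (fun j => by simp [sum_add_distrib])
  exact ⟨f, hz, (load_mono hx' f 1).trans h1, (load_mono hy' f 2).trans h2⟩

theorem load_le_of_scaled {x : Fin 3 → Fin 3 → ℝ} {a : ℝ} (ha : 0 ≤ a)
    (h0 : a = 0 → ∀ i j, x i j = 0) {f : Fin 3 → Fin 3 → Fin 3} {k : Fin 3}
    (h : load (fun i j => 18 / a * x i j) f k ≤ 19) : load x f k ≤ 19 / 18 * a := by
  rcases ha.eq_or_lt with rfl | ha
  · simp [load, h0 rfl]
  · rw [load_const_mul, div_mul_eq_mul_div, div_le_iff₀ ha] at h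
    linarith

/-- Three agents can share the cells of a `3 × 3` table so that the first one gets at most a third
of her total, and the others at most `19 / 18` of a bound on all rows, respectively columns. -/
theorem exists_split {x y : Fin 3 → Fin 3 → ℝ} (z : Fin 3 → Fin 3 → ℝ) {a b : ℝ}
    (hx : ∀ i j, 0 ≤ x i j) (hy : ∀ i j, 0 ≤ y i j)
    (hxr : ∀ i, ∑ j, x i j ≤ a) (hyc : ∀ j, ∑ i, y i j ≤ b) :
    ∃ f, 3 * load z f 0 ≤ ∑ i, ∑ j, z i j ∧ load x f 1 ≤ 19 / 18 * a ∧
      load y f 2 ≤ 19 / 18 * b := by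
  have ha : 0 ≤ a := (sum_nonneg fun j _ => hx 0 j).trans (hxr 0)
  have hb : 0 ≤ b := (sum_nonneg fun i _ => hy i 0).trans (hyc 0)
  have scale : ∀ {c s : ℝ}, 0 ≤ c → s ≤ c → 18 / c * s ≤ 18 := by
    intro c s hc hs
    rcases hc.eq_or_lt with rfl | hc
    · simp
    · rw [div_mul_eq_mul_div, div_le_iff₀ hc]
      linarith
  obtain ⟨f, hz, h1, h2⟩ := exists_split_of_sum_le (x := fun i j => 18 / a * x i j)
    (y := fun i j => 18 / b * y i j) z
    (fun i j => mul_nonneg (by positivity) (hx i j))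
    (fun i j => mul_nonneg (by positivity) (hy i j))
    (fun i => by rw [← mul_sum]; exact scale ha (hxr i))
    (fun j => by rw [← mul_sum]; exact scale hb (hyc j))
  refine ⟨f, hz, load_le_of_scaled ha ?_ h1, load_le_of_scaled hb ?_ h2⟩
  · rintro rfl i j
    exact le_antisymm ((single_le_sum (fun j _ => hx i j) (mem_univ j)).trans (hxr i)) (hx i j)
  · rintro rfl i j
    exact le_antisymm ((single_le_sum (f := fun i => y i j) (fun i _ => hy i j)
      (mem_univ i)).trans (hyc j)) (hy i j)

section Items

variable {M : Type*} [Fintype M]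

theorem sum_bundleVal {n : ℕ} (v : M → ℝ) (f : M → Fin n) : ∑ j, bundleVal v f j = ∑ e, v e :=
  sum_fiberwise univ f v

variable [DecidableEq M] {n : ℕ} [NeZero n]

theorem exists_bundleVal_le_mmS (v : M → ℝ) :
    ∃ f : M → Fin n, ∀ j, bundleVal v f j ≤ mmS n v := by
  obtain ⟨f, -, hf⟩ := exists_mem_eq_inf' univ_nonempty fun f : M → Fin n =>
    univ.sup' univ_nonempty fun j => bundleVal v f j
  exact ⟨f, fun j => (le_sup' (fun j => bundleVal v f j) (mem_univ j)).trans hf.ge⟩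

theorem sum_le_mul_mmS (v : M → ℝ) : ∑ e, v e ≤ n * mmS n v := by
  obtain ⟨f, hf⟩ := exists_bundleVal_le_mmS (n := n) v
  rw [← sum_bundleVal v f]
  simpa using sum_le_sum fun j (_ : j ∈ univ) => hf j

end Items

/-- The table of costs of the intersections of the bundles of `r` with those of `c`. -/
noncomputable def cells {M : Type*} [Fintype M] (v : M → ℝ) (r c : M → Fin 3) (i j : Fin 3) : ℝ :=
  ∑ e, if r e = i then if c e = j then v e else 0 else 0

section Cells

variable {M : Type*} [Fintype M] (v : M → ℝ) (r c : M → Fin 3)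

theorem cells_nonneg {v : M → ℝ} (hv : ∀ e, 0 ≤ v e) (i j : Fin 3) : 0 ≤ cells v r c i j :=
  sum_nonneg fun e _ => by split_ifs <;> simp [hv]

theorem sum_cells_row (i : Fin 3) : ∑ j, cells v r c i j = bundleVal v r i := by
  unfold cells bundleVal
  rw [sum_comm, sum_filter]
  refine sum_congr rfl fun e _ => ?_
  split_ifs <;> simp

theorem sum_cells_col (j : Fin 3) : ∑ i, cells v r c i j = bundleVal v c j := by
  unfold cells bundleVal
  rw [sum_comm, sum_filter]
  exact sum_congr rfl fun e _ => by simp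

theorem load_cells (f : Fin 3 → Fin 3 → Fin 3) (k : Fin 3) :
    load (cells v r c) f k = bundleVal v (fun e => f (r e) (c e)) k := by
  have h : ∀ i j, (if f i j = k then cells v r c i j else 0) =
      ∑ e, if r e = i then if c e = j then if f i j = k then v e else 0 else 0 else 0 := by
    intro i j
    split_ifs <;> simp [cells]
  simp only [load, h]
  calc _ = ∑ i, ∑ e, ∑ j,
        (if r e = i then if c e = j then if f i j = k then v e else 0 else 0 else 0) :=
        sum_congr rfl fun i _ => sum_comm
    _ = ∑ e, ∑ i, ∑ j,
        (if r e = i then if c e = j then if f i j = k then v e else 0 else 0 else 0) := sum_comm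
    _ = ∑ e, if f (r e) (c e) = k then v e else 0 := by
        refine sum_congr rfl fun e _ => ?_
        rw [sum_eq_single (r e) (fun i _ hi => by simp [hi.symm]) (by simp)]
        simp
    _ = _ := (sum_filter _ _).symm

end Cells

/-- Every instance with three agents with additive nonnegative cost
functions over chores admits a (19/18)-minimax allocation. -/
theorem exists_nineteen_eighteenths_minimax_allocation {M : Type*} [Fintype M]
    [DecidableEq M] (v : Fin 3 → M → ℝ) (hv : ∀ i e, 0 ≤ v i e) :
    ∃ A : M → Fin 3, ∀ i, bundleVal (v i) A i ≤ (19/18 : ℝ) * mmS 3 (v i) := by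
  obtain ⟨r, hr⟩ := exists_bundleVal_le_mmS (n := 3) (v 1)
  obtain ⟨c, hc⟩ := exists_bundleVal_le_mmS (n := 3) (v 2)
  obtain ⟨f, h0, h1, h2⟩ := exists_split (cells (v 0) r c)
    (cells_nonneg r c (hv 1)) (cells_nonneg r c (hv 2))
    (fun i => (sum_cells_row _ r c i).trans_le (hr i))
    (fun j => (sum_cells_col _ r c j).trans_le (hc j))
  rw [load_cells] at h0 h1 h2
  simp only [sum_cells_row, sum_bundleVal] at h0
  refine ⟨fun e => f (r e) (c e), fun i => ?_⟩
  fin_cases i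
  · have hs := sum_le_mul_mmS (n := 3) (v 0)
    have hs0 : 0 ≤ ∑ e, v 0 e := sum_nonneg fun e _ => hv 0 e
    norm_num at hs ⊢
    linarith
  · exact h1
  · exact h2
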